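/- Let L be a finitely generated S-module and 𝔞 an ideal of S. Then for almost all α there are canonical isomorphisms (0 :_L 𝔞)_α ≅ 0 :_{L_α} 𝔞_α and (𝔞L)_α ≅ 𝔞_α L_α. -/

import Mathlib

set_option maxHeartbeats 1000000
set_option synthInstance.maxHeartbeats 1000000

noncomputable section

namespace Spl

open MvPolynomial

/-- "Q(α) holds for almost all α ∈ K^m", i.e. away from a proper algebraic
subvariety of `K^m`. -/
def AlmostAll (K : Type) [Field K] (m : ℕ) (Q : (Fin m → K) → Prop) : Prop :=
  ∃ c : MvPolynomial (Fin m) K, c ≠ 0 ∧ ∀ α : Fin m → K, MvPolynomial.eval α c ≠ 0 → Q α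

variable (k K : Type) [Field k] [Field K] [Algebra k K]

/-- the field k(u) of rational functions in u = (u_1, ..., u_m) -/
abbrev kU (m : ℕ) := FractionRing (MvPolynomial (Fin m) k)

/-- the polynomial ring R = k(u)[X_1, ..., X_n] -/
abbrev Rg (m n : ℕ) := MvPolynomial (Fin n) (kU k m)

/-- the subfield k(α) ⊆ K generated by α = (α_1, ..., α_m) over k -/
abbrev kA {m : ℕ} (α : Fin m → K) := IntermediateField.adjoin k (Set.range α)

/-- the polynomial ring R_α = k(α)[X_1, ..., X_n] -/
abbrev Ra {m : ℕ} (n : ℕ) (α : Fin m → K) := MvPolynomial (Fin n) (kA k K α)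

/-- evaluation u ↦ α, from k[u] to k(α) -/
def evalα {m : ℕ} (α : Fin m → K) : MvPolynomial (Fin m) k →+* kA k K α :=
  (MvPolynomial.aeval fun i =>
    (⟨α i, IntermediateField.subset_adjoin k (Set.range α) ⟨i, rfl⟩⟩ : kA k K α)).toRingHom

/-- the inclusion k[u][X] → R = k(u)[X] -/
def toR (m n : ℕ) : MvPolynomial (Fin n) (MvPolynomial (Fin m) k) →+* Rg k m n :=
  MvPolynomial.map (algebraMap (MvPolynomial (Fin m) k) (kU k m))

/-- substitution u ↦ α, from k[u][X] to R_α = k(α)[X] -/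
def toRa {m : ℕ} (n : ℕ) (α : Fin m → K) :
    MvPolynomial (Fin n) (MvPolynomial (Fin m) k) →+* Ra k K n α :=
  MvPolynomial.map (evalα k K α)

/-- Krull's specialization I_α = { f(α,X) | f(u,X) ∈ I ∩ k[u,X] } of an ideal I ⊆ R
(as an ideal of R_α, i.e. the ideal spanned by the specialized elements). -/
def idealSpec {m : ℕ} (n : ℕ) (α : Fin m → K) (I : Ideal (Rg k m n)) :
    Ideal (Ra k K n α) :=
  Ideal.span (toRa k K n α '' { f | toR k m n f ∈ I })

/-- `ElemSpec k K n α f fα` : fα is the specialization of f ∈ R at α, i.e. writing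
f = p(u,X)/q(u) with q(α) ≠ 0 one has fα = p(α,X)/q(α). -/
def ElemSpec {m : ℕ} (n : ℕ) (α : Fin m → K) (f : Rg k m n) (fα : Ra k K n α) : Prop :=
  ∃ (p : MvPolynomial (Fin n) (MvPolynomial (Fin m) k)) (q : MvPolynomial (Fin m) k),
    evalα k K α q ≠ 0 ∧
    MvPolynomial.C (algebraMap (MvPolynomial (Fin m) k) (kU k m) q) * f = toR k m n p ∧
    MvPolynomial.C (evalα k K α q) * fα = toRa k K n α p

variable {k K}

/-- `LocElemSpec P ℘ a aα` : aα ∈ S_α = (R_α)_℘ is the specialization of a ∈ S = R_P,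
i.e. writing a = f/g with f, g ∈ R, g ∉ P, one has g_α ∉ ℘ and aα = f_α/g_α. -/
def LocElemSpec {m n : ℕ} {α : Fin m → K} (P : Ideal (Rg k m n)) [P.IsPrime]
    (℘ : Ideal (Ra k K n α)) [℘.IsPrime]
    {S : Type} [CommRing S] [Algebra (Rg k m n) S] [IsLocalization.AtPrime S P]
    {Sα : Type} [CommRing Sα] [Algebra (Ra k K n α) Sα] [IsLocalization.AtPrime Sα ℘]
    (a : S) (aα : Sα) : Prop :=
  ∃ (f g : Rg k m n) (fα gα : Ra k K n α) (hg : g ∈ P.primeCompl)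
    (hgα : gα ∈ ℘.primeCompl),
    ElemSpec k K n α f fα ∧ ElemSpec k K n α g gα ∧
    a = IsLocalization.mk' S f ⟨g, hg⟩ ∧
    aα = IsLocalization.mk' Sα fα ⟨gα, hgα⟩

/-- entrywise specialization of matrices, relative to an element-specialization
relation `E`. -/
def MatSpec {S T : Type} (E : S → T → Prop) {r s : ℕ}
    (A : Matrix (Fin r) (Fin s) S) (B : Matrix (Fin r) (Fin s) T) : Prop :=
  ∀ i j, E (A i j) (B i j)

/-- the cokernel of the linear map attached to a matrix A, i.e. the module
presented by A. -/
abbrev MatCoker {S : Type} [CommRing S] {r s : ℕ} (A : Matrix (Fin r) (Fin s) S) :=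
  (Fin r → S) ⧸ LinearMap.range A.mulVecLin

/-- a finite free presentation F_1 → F_0 → L → 0 of the module L, where the map
F_1 → F_0 is given by the matrix A and the map F_0 → L is π. -/
structure Present (S : Type) [CommRing S] (r s : ℕ) (L : Type) [AddCommGroup L]
    [Module S L] where
  A : Matrix (Fin r) (Fin s) S
  π : (Fin r → S) →ₗ[S] L
  surj : Function.Surjective π
  ker_eq : LinearMap.ker π = LinearMap.range A.mulVecLin

theorem comm_le {S : Type} [CommRing S] {r s r' s' : ℕ} {B : Matrix (Fin r) (Fin s) S}
    {C : Matrix (Fin r') (Fin s') S} {W : Matrix (Fin r') (Fin r) S}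
    {W1 : Matrix (Fin s') (Fin s) S} (h : W * B = C * W1) :
    LinearMap.range B.mulVecLin ≤ (LinearMap.range C.mulVecLin).comap W.mulVecLin := by
  rintro x ⟨y, rfl⟩
  exact ⟨W1.mulVecLin y, by
    simp only [Matrix.mulVecLin_apply, Matrix.mulVec_mulVec, h]⟩

/-- the map between the modules presented by B and C induced by the matrix W
(a specialization of a lift of a map between the presented modules). -/
def cokerMap {S : Type} [CommRing S] {r s r' s' : ℕ} {B : Matrix (Fin r) (Fin s) S}
    {C : Matrix (Fin r') (Fin s') S} (W : Matrix (Fin r') (Fin r) S)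
    (h : LinearMap.range B.mulVecLin ≤ (LinearMap.range C.mulVecLin).comap W.mulVecLin) :
    MatCoker B →ₗ[S] MatCoker C :=
  Submodule.mapQ _ _ W.mulVecLin h

/-- a lift of a homomorphism v : L → M to given finite free presentations of L and M:
a commutative diagram whose vertical maps are given by the matrices V1, V0. -/
structure MapLift {S : Type} [CommRing S] {rL sL rM sM : ℕ} {L M : Type}
    [AddCommGroup L] [Module S L] [AddCommGroup M] [Module S M]
    (pL : Present S rL sL L) (pM : Present S rM sM M) (v : L →ₗ[S] M) where
  V0 : Matrix (Fin rM) (Fin rL) S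
  V1 : Matrix (Fin sM) (Fin sL) S
  comm0 : pM.π ∘ₗ V0.mulVecLin = v ∘ₗ pL.π
  comm1 : V0 * pL.A = pM.A * V1

/-- Krull dimension of a module, dim L = dim S/Ann L. -/
def moduleDim (S : Type) [CommRing S] (L : Type) [AddCommGroup L] [Module S L] :
    WithBot ℕ∞ :=
  ringKrullDim (S ⧸ Module.annihilator S L)

/-- height of an ideal: the infimum of dim S_p over the primes p ⊇ I. -/
def idealHeight {S : Type} [CommRing S] (I : Ideal S) : WithBot ℕ∞ :=
  sInf { d | ∃ (p : Ideal S) (hp : p.IsPrime), I ≤ p ∧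
    d = ringKrullDim (Localization (@Ideal.primeCompl _ _ p hp)) }

/-- length of a module: the longest chain of submodules. -/
def moduleLength (S : Type) [CommRing S] (L : Type) [AddCommGroup L] [Module S L] :
    WithBot ℕ∞ :=
  Order.krullDim (Submodule S L)

/-- grade(𝔞, L) ≥ t : there is an L-regular sequence of length t in 𝔞. -/
def GradeGE {S : Type} [CommRing S] (𝔞 : Ideal S) (L : Type) [AddCommGroup L]
    [Module S L] (t : ℕ) : Prop :=
  ∃ rs : List S, rs.length = t ∧ (∀ x ∈ rs, x ∈ 𝔞) ∧ RingTheory.Sequence.IsRegular L rs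

/-- grade(𝔞, L) : the length of a maximal L-regular sequence in 𝔞. -/
def grade {S : Type} [CommRing S] (𝔞 : Ideal S) (L : Type) [AddCommGroup L]
    [Module S L] : ℕ∞ :=
  sSup { t : ℕ∞ | ∃ t' : ℕ, t = (t' : ℕ∞) ∧ GradeGE 𝔞 L t' }

/-- depth of a module over a local ring: grade(𝔪, L). -/
def depth (S : Type) [CommRing S] [IsLocalRing S] (L : Type) [AddCommGroup L]
    [Module S L] : ℕ∞ :=
  grade (IsLocalRing.maximalIdeal S) L

/-- proj dim L ≤ d : L admits a finite free resolution of length ≤ d, encoded as a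
(possibly infinite) free resolution ⋯ → F_1 → F_0 → L → 0 with F_j = 0 for j > d. -/
def ProjDimLE (S : Type) [CommRing S] (L : Type) [AddCommGroup L] [Module S L]
    (d : ℕ) : Prop :=
  ∃ (r : ℕ → ℕ) (A : ∀ j : ℕ, Matrix (Fin (r j)) (Fin (r (j + 1))) S)
    (π : (Fin (r 0) → S) →ₗ[S] L),
    Function.Surjective π ∧ LinearMap.ker π = LinearMap.range (A 0).mulVecLin ∧
    (∀ j : ℕ, LinearMap.ker (A j).mulVecLin = LinearMap.range (A (j + 1)).mulVecLin) ∧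
    ∀ j : ℕ, d < j → r j = 0

/-- projective dimension of a module, as an extended natural number. -/
def projDim (S : Type) [CommRing S] (L : Type) [AddCommGroup L] [Module S L] : ℕ∞ :=
  sInf { d : ℕ∞ | ∃ d' : ℕ, d = (d' : ℕ∞) ∧ ProjDimLE S L d' }

/-- the i-th local cohomology module H^i_𝔞(L) as a module. -/
abbrev localCoh {S : Type} [CommRing S] (𝔞 : Ideal S) (i : ℕ) (L : Type)
    [AddCommGroup L] [Module S L] : ModuleCat S :=
  (localCohomology 𝔞 i).obj (ModuleCat.of S L)

/-- the colon submodule (0 :_L 𝔞) = { x ∈ L | 𝔞 x = 0 }. -/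
def colonSubmodule {S : Type} [CommRing S] (𝔞 : Ideal S) (L : Type) [AddCommGroup L]
    [Module S L] : Submodule S L where
  carrier := { x | ∀ c ∈ 𝔞, c • x = 0 }
  add_mem' := by
    intro a b ha hb c hc
    rw [smul_add, ha c hc, hb c hc, add_zero]
  zero_mem' := by
    intro c _
    rw [smul_zero]
  smul_mem' := by
    intro s x hx c hc
    rw [smul_comm, hx c hc, smul_zero]

/-- a (partial) system of parameters: the d = dim L elements a_1, ..., a_d lie in the
maximal ideal and L/(a_1, ..., a_d)L has dimension ≤ 0. -/
def IsSOP (S : Type) [CommRing S] [IsLocalRing S] (L : Type) [AddCommGroup L]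
    [Module S L] {d : ℕ} (a : Fin d → S) : Prop :=
  (∀ i, a i ∈ IsLocalRing.maximalIdeal S) ∧
  moduleDim S L = (d : ℕ∞) ∧
  moduleDim S (L ⧸ (Ideal.span (Set.range a) • (⊤ : Submodule S L))) ≤ 0

/-- a standard system of parameters: (a_1, ..., a_d) H^i_𝔪(L/(a_1, ..., a_j)L) = 0
for all i + j < d. -/
def IsStandardSOP (S : Type) [CommRing S] [IsLocalRing S] (L : Type) [AddCommGroup L]
    [Module S L] {d : ℕ} (a : Fin d → S) : Prop :=
  IsSOP S L a ∧
  ∀ i j : ℕ, i + j < d →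
    Ideal.span (Set.range a) ≤ Module.annihilator S
      (localCoh (IsLocalRing.maximalIdeal S) i
        (L ⧸ (Ideal.span (a '' { x : Fin d | (x : ℕ) < j }) • (⊤ : Submodule S L))))

/-- a standard ideal for L: an 𝔪-primary ideal 𝔞 such that every system of
parameters of L contained in 𝔞 is standard. -/
def IsStandardIdeal (S : Type) [CommRing S] [IsLocalRing S] (L : Type) [AddCommGroup L]
    [Module S L] (𝔞 : Ideal S) : Prop :=
  𝔞.radical = IsLocalRing.maximalIdeal S ∧
  ∀ (d : ℕ) (a : Fin d → S), (∀ i, a i ∈ 𝔞) → IsSOP S L a → IsStandardSOP S L a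

open scoped Matrix

/-- A `U`-module has a generic basis if a linearly independent family spans it after inverting
a single nonzero scalar. -/
def HasGenericBasis (U M : Type) [CommRing U] [AddCommGroup M] [Module U M] : Prop :=
  ∃ h : U, h ≠ 0 ∧ ∃ (I : Type) (v : I → M), LinearIndependent U v ∧
    ∀ y, ∃ e : ℕ, h ^ e • y ∈ Submodule.span U (Set.range v)

theorem HasGenericBasis.of_subsingleton {U M : Type} [CommRing U] [Nontrivial U] [AddCommGroup M]
    [Module U M] [Subsingleton M] : HasGenericBasis U M :=
  ⟨1, one_ne_zero, PEmpty, fun i => i.elim, linearIndependent_empty_type,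
    fun y => ⟨0, by rw [Subsingleton.elim (1 ^ 0 • y) 0]; exact zero_mem _⟩⟩

theorem HasGenericBasis.of_equiv {U M M' : Type} [CommRing U] [AddCommGroup M] [Module U M]
    [AddCommGroup M'] [Module U M'] (f : M ≃ₗ[U] M') (H : HasGenericBasis U M') :
    HasGenericBasis U M := by
  obtain ⟨h, h0, I, v, hv, hs⟩ := H
  refine ⟨h, h0, I, f.symm ∘ v, hv.map' _ (LinearEquiv.ker _), fun y => ?_⟩
  obtain ⟨e, he⟩ := hs (f y)
  refine ⟨e, ?_⟩
  have := Submodule.mem_map_of_mem (f := f.symm.toLinearMap) he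
  rw [Submodule.map_span, ← Set.range_comp] at this
  simpa using this

theorem HasGenericBasis.of_exact {U M₁ M₂ M₃ : Type} [CommRing U] [IsDomain U]
    [AddCommGroup M₁] [Module U M₁] [AddCommGroup M₂] [Module U M₂] [AddCommGroup M₃]
    [Module U M₃] (f : M₁ →ₗ[U] M₂) (g : M₂ →ₗ[U] M₃) (hf : Function.Injective f)
    (hg : Function.Surjective g) (hfg : Function.Exact f g)
    (H₁ : HasGenericBasis U M₁) (H₃ : HasGenericBasis U M₃) : HasGenericBasis U M₂ := by
  obtain ⟨h₁, h₁0, I₁, v₁, hv₁, hs₁⟩ := H₁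
  obtain ⟨h₃, h₃0, I₃, v₃, hv₃, hs₃⟩ := H₃
  choose s hs using hg
  have hgs : g ∘ (s ∘ v₃) = v₃ := funext fun i => hs _
  refine ⟨h₁ * h₃, mul_ne_zero h₁0 h₃0, I₁ ⊕ I₃, Sum.elim (f ∘ v₁) (s ∘ v₃), ?_, fun y => ?_⟩
  · refine (hv₁.map' f (LinearMap.ker_eq_bot.2 hf)).sum_type ?_ ?_
    · exact LinearIndependent.of_comp g (by rwa [hgs])
    · rw [Submodule.disjoint_def]
      intro x hx hx'
      have hgx : g x = 0 := by
        refine Submodule.span_induction ?_ (map_zero g) (fun _ _ _ _ ha hb => by simp [ha, hb])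
          (fun _ _ _ ha => by simp [ha]) hx
        rintro _ ⟨i, rfl⟩
        exact hfg.apply_apply_eq_zero _
      rw [Finsupp.mem_span_range_iff_exists_finsupp] at hx'
      obtain ⟨c, rfl⟩ := hx'
      have hc : c = 0 := by
        refine linearIndependent_iff.1 hv₃ c ?_
        rw [Finsupp.linearCombination_apply, ← hgx, map_finsuppSum]
        simp only [map_smul, Function.comp_apply, hs]
      simp [hc]
  · rw [Set.Sum.elim_range, Submodule.span_union]
    obtain ⟨e, he⟩ := hs₃ (g y)
    rw [← hgs, Set.range_comp, ← Submodule.map_span] at he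
    obtain ⟨z, hz, hze⟩ := he
    obtain ⟨x, hx⟩ := (hfg (h₃ ^ e • y - z)).1 (by rw [map_sub, hze, map_smul, sub_self])
    obtain ⟨e', he'⟩ := hs₁ x
    have hfx := Submodule.mem_map_of_mem (f := f) he'
    rw [Submodule.map_span, ← Set.range_comp, map_smul, hx] at hfx
    refine ⟨e + e', ?_⟩
    have : (h₁ * h₃) ^ (e + e') • y = (h₁ ^ e * h₃ ^ e') • (h₁ ^ e' • (h₃ ^ e • y - z))
        + (h₁ ^ e * h₃ ^ e' * h₁ ^ e') • z := by
      rw [smul_sub, smul_sub, smul_smul, smul_smul, smul_smul, sub_add_cancel]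
      congr 1
      ring
    rw [this]
    exact add_mem (Submodule.smul_mem _ _ (Submodule.mem_sup_left hfx))
      (Submodule.smul_mem _ _ (Submodule.mem_sup_right hz))

theorem hasGenericBasis_quotient_ideal {U : Type} [CommRing U] [IsDomain U] {n : ℕ}
    (J : Ideal (MvPolynomial (Fin n) U)) :
    HasGenericBasis U (MvPolynomial (Fin n) U ⧸ J) := by
  classical
  let o : MonomialOrder (Fin n) := MonomialOrder.lex
  let D : Set (Fin n →₀ ℕ) := {d | ∃ f ∈ J, f ≠ 0 ∧ o.degree f = d}
  let D₀ : Set (Fin n →₀ ℕ) := {d | Minimal (· ∈ D) d}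
  have hfin : D₀.Finite := WellQuasiOrderedLE.finite_of_isAntichain (setOfPred_minimal_antichain _)
  have hD₀ : ∀ d : D₀, ∃ f ∈ J, f ≠ 0 ∧ o.degree f = d := fun d => d.2.1
  choose g hgJ hg0 hgd using hD₀
  have := hfin.fintype
  have lt_of : ∀ f f' : MvPolynomial (Fin n) U, f' ≠ 0 →
      o.toSyn (o.degree f') ≤ o.toSyn (o.degree f) → coeff (o.degree f) f' = 0 →
      o.toSyn (o.degree f') < o.toSyn (o.degree f) := by
    intro f f' h0 hle hc
    refine lt_of_le_of_ne hle fun heq => ?_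
    rw [← o.toSyn.injective heq] at hc
    exact o.leadingCoeff_ne_zero_iff.2 h0 hc
  set h : U := ∏ d : D₀, o.leadingCoeff (g d)
  have h0 : h ≠ 0 := Finset.prod_ne_zero_iff.2 fun d _ => o.leadingCoeff_ne_zero_iff.2 (hg0 d)
  let v : {d : Fin n →₀ ℕ // d ∉ D} → MvPolynomial (Fin n) U := fun d => monomial d.1 1
  refine ⟨h, h0, {d : Fin n →₀ ℕ // d ∉ D}, fun d => Ideal.Quotient.mk J (v d), ?_, fun y => ?_⟩
  · rw [linearIndependent_iff]
    intro c hc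
    have hmem : Finsupp.linearCombination U v c ∈ J := by
      rw [← Ideal.Quotient.eq_zero_iff_mem, ← Ideal.Quotient.mkₐ_eq_mk U,
        ← AlgHom.toLinearMap_apply, Finsupp.apply_linearCombination]
      exact hc
    have hco : ∀ d : Fin n →₀ ℕ, coeff d (Finsupp.linearCombination U v c) =
        if hd : d ∉ D then c ⟨d, hd⟩ else 0 := by
      intro d
      rw [Finsupp.linearCombination_apply, Finsupp.sum, coeff_sum]
      simp only [v, coeff_smul, coeff_monomial, smul_eq_mul, mul_ite, mul_one, mul_zero]
      split_ifs with hd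
      · refine Finset.sum_eq_zero fun b _ => if_neg ?_
        rintro rfl
        exact b.2 hd
      · rw [Finset.sum_eq_single ⟨d, hd⟩]
        · simp
        · rintro b - hb
          rw [if_neg]
          rintro rfl
          exact hb rfl
        · simp
    have hz : Finsupp.linearCombination U v c = 0 := by
      by_contra hne
      have h1 := o.leadingCoeff_ne_zero_iff.2 hne
      rw [MonomialOrder.leadingCoeff, hco] at h1
      rw [dif_neg] at h1
      · exact h1 rfl
      · exact not_not.2 ⟨_, hmem, hne, rfl⟩
    ext ⟨d, hd⟩
    have := hco d
    rw [hz, dif_pos hd] at this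
    simpa using this.symm
  · obtain ⟨y, rfl⟩ := Ideal.Quotient.mk_surjective y
    suffices H : ∀ (d : o.syn) (f : MvPolynomial (Fin n) U), o.toSyn (o.degree f) = d →
        ∃ e : ℕ, h ^ e • Ideal.Quotient.mk J f ∈
          Submodule.span U (Set.range fun d => Ideal.Quotient.mk J (v d)) from H _ y rfl
    intro d
    induction d using WellFoundedLT.induction with
    | ind d ih =>
    rintro f rfl
    by_cases hf : f = 0
    · exact ⟨0, by simp [hf]⟩
    by_cases hd : o.degree f ∈ D
    · obtain ⟨d₀, hle, hd₀⟩ := exists_minimal_le_of_wellFoundedLT (· ∈ D) _ hd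
      let gg := g ⟨d₀, hd₀⟩
      have hggd : o.degree gg = d₀ := hgd ⟨d₀, hd₀⟩
      obtain ⟨a, ha⟩ := exists_add_of_le hle
      let f' := C (o.leadingCoeff gg) * f - monomial a (o.leadingCoeff f) * gg
      have hmk : Ideal.Quotient.mk J f' = o.leadingCoeff gg • Ideal.Quotient.mk J f := by
        rw [Ideal.Quotient.mk_eq_mk_iff_sub_mem .. |>.2 (?_ : f' - C (o.leadingCoeff gg) * f ∈ J)]
        · rw [C_mul']
          rfl
        · simp only [f', sub_sub_cancel_left]
          exact neg_mem (J.mul_mem_left _ (hgJ _))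
      have key : ∃ e : ℕ, h ^ e • Ideal.Quotient.mk J f' ∈
          Submodule.span U (Set.range fun d => Ideal.Quotient.mk J (v d)) := by
        by_cases hf' : f' = 0
        · exact ⟨0, by simp [hf']⟩
        refine ih _ (lt_of f f' hf' ?_ ?_) f' rfl
        · refine o.degree_sub_le.trans (sup_le ?_ ?_)
          · refine o.degree_mul_le.trans ?_
            simp
          · refine o.degree_mul_le.trans ?_
            rw [ha, add_comm d₀, hggd, map_add, map_add]
            exact add_le_add_left (o.degree_monomial_le _) _
        · simp only [f', coeff_sub, coeff_C_mul]
          nth_rw 2 [ha]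
          rw [add_comm d₀, coeff_monomial_mul, ← hggd]
          simp only [MonomialOrder.leadingCoeff]
          ring
      obtain ⟨e, he⟩ := key
      refine ⟨e + 1, ?_⟩
      have : h ^ (e + 1) • Ideal.Quotient.mk J f =
          (∏ d ∈ Finset.univ.erase ⟨d₀, hd₀⟩, o.leadingCoeff (g d)) •
            (h ^ e • Ideal.Quotient.mk J f') := by
        rw [hmk, smul_smul, smul_smul]
        congr 1
        rw [pow_succ]
        nth_rw 2 [show h = o.leadingCoeff gg * _ from
          (Finset.mul_prod_erase Finset.univ _ (Finset.mem_univ (⟨d₀, hd₀⟩ : D₀))).symm]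
        ring
      rw [this]
      exact Submodule.smul_mem _ _ he
    · let f' := f - monomial (o.degree f) (o.leadingCoeff f)
      have key : ∃ e : ℕ, h ^ e • Ideal.Quotient.mk J f' ∈
          Submodule.span U (Set.range fun d => Ideal.Quotient.mk J (v d)) := by
        by_cases hf' : f' = 0
        · exact ⟨0, by simp [hf']⟩
        refine ih _ (lt_of f f' hf' ?_ ?_) f' rfl
        · exact o.degree_sub_le.trans (sup_le le_rfl (o.degree_monomial_le _))
        · simp [f', MonomialOrder.leadingCoeff]
      obtain ⟨e, he⟩ := key
      refine ⟨e, ?_⟩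
      have : Ideal.Quotient.mk J f = Ideal.Quotient.mk J f' +
          o.leadingCoeff f • Ideal.Quotient.mk J (v ⟨_, hd⟩) := by
        have h2 : o.leadingCoeff f • Ideal.Quotient.mk J (v ⟨_, hd⟩) =
          Ideal.Quotient.mk J (o.leadingCoeff f • v ⟨_, hd⟩) := rfl
        rw [h2, ← map_add]
        congr 1
        simp [f', v, smul_monomial]
      rw [this, smul_add]
      exact add_mem he (Submodule.smul_mem _ _ (Submodule.smul_mem _ _
        (Submodule.subset_span ⟨_, rfl⟩)))

theorem hasGenericBasis_of_finite {U : Type} [CommRing U] [IsDomain U] [IsNoetherianRing U]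
    {n : ℕ} (M : Type) [AddCommGroup M] [Module (MvPolynomial (Fin n) U) M]
    [hM : Module.Finite (MvPolynomial (Fin n) U) M] [Module U M]
    [IsScalarTower U (MvPolynomial (Fin n) U) M] : HasGenericBasis U M := by
  suffices H : ∀ [Module U M] [IsScalarTower U (MvPolynomial (Fin n) U) M],
      HasGenericBasis U M from H
  induction hM using IsNoetherianRing.induction_on_isQuotientEquivQuotientPrime
    (MvPolynomial (Fin n) U) with
  | subsingleton N => exact .of_subsingleton
  | quotient N p f =>
    exact .of_equiv (f.restrictScalars U) (hasGenericBasis_quotient_ideal _)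
  | exact N₁ N₂ N₃ f g hf hg hfg h₁ h₃ =>
    intro _ _
    let := Module.compHom N₁ (algebraMap U (MvPolynomial (Fin n) U))
    let := Module.compHom N₃ (algebraMap U (MvPolynomial (Fin n) U))
    have : IsScalarTower U (MvPolynomial (Fin n) U) N₁ :=
      IsScalarTower.of_algebraMap_smul fun _ _ => rfl
    have : IsScalarTower U (MvPolynomial (Fin n) U) N₃ :=
      IsScalarTower.of_algebraMap_smul fun _ _ => rfl
    exact .of_exact (f.restrictScalars U) (g.restrictScalars U) hf hg hfg h₁ h₃

theorem exists_C_mul_eq_map {U F σ : Type} [CommRing U] [Field F] (φ : U →+* F)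
    (hφ : ∀ x : F, ∃ a b : U, φ b ≠ 0 ∧ φ b * x = φ a) (f : MvPolynomial σ F) :
    ∃ (b : U) (p : MvPolynomial σ U), φ b ≠ 0 ∧ C (φ b) * f = map φ p := by
  induction f using MvPolynomial.induction_on with
  | C x =>
    obtain ⟨a, b, hb, h⟩ := hφ x
    exact ⟨b, C a, hb, by rw [map_C, ← h, C_mul]⟩
  | add f g hf hg =>
    obtain ⟨b, p, hb, h⟩ := hf
    obtain ⟨b', p', hb', h'⟩ := hg
    refine ⟨b * b', C b' * p + C b * p', by simp [hb, hb'], ?_⟩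
    simp only [map_add, map_mul, map_C, ← h, ← h']
    ring
  | mul_X f i hf =>
    obtain ⟨b, p, hb, h⟩ := hf
    exact ⟨b, p * X i, hb, by rw [← mul_assoc, h, map_mul, map_X]⟩

/-- Finitely many fractions have a common denominator. -/
theorem exists_common_denom {A S ι : Type} [CommRing A] [CommRing S] [Finite ι] (D : Submonoid A)
    (j : A →+* S) (x : ι → S) (hx : ∀ i, ∃ d ∈ D, ∃ p, j d * x i = j p) :
    ∃ d ∈ D, ∃ p : ι → A, ∀ i, j d * x i = j (p i) := by
  classical
  have := Fintype.ofFinite ι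
  choose d hd p hp using hx
  refine ⟨∏ i, d i, prod_mem fun i _ => hd i,
    fun i => (∏ i' ∈ Finset.univ.erase i, d i') * p i, fun i => ?_⟩
  rw [map_mul, ← hp, ← Finset.prod_erase_mul _ _ (Finset.mem_univ i), map_mul, mul_assoc]

theorem map_mulVec_comp {A B ι κ : Type} [CommRing A] [CommRing B] [Fintype κ]
    (ψ : A →+* B) (N : Matrix ι κ A) (w : κ → A) :
    N.map ψ *ᵥ (ψ ∘ w) = ψ ∘ (N *ᵥ w) :=
  _root_.funext fun i => (ψ.map_mulVec N w i).symm

theorem exists_ker_specialization {U : Type} [CommRing U] [IsDomain U] [IsNoetherianRing U]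
    {n : ℕ} {ι κ : Type} [Fintype ι] [Fintype κ] (N : Matrix ι κ (MvPolynomial (Fin n) U)) :
    ∃ h : U, h ≠ 0 ∧ ∀ (F : Type) [Field F] (φ : U →+* F),
      (∀ x : F, ∃ a b : U, φ b ≠ 0 ∧ φ b * x = φ a) → φ h ≠ 0 →
      ∀ z : κ → MvPolynomial (Fin n) F, N.map (map φ) *ᵥ z = 0 →
        z ∈ Submodule.span (MvPolynomial (Fin n) F) ((map φ ∘ ·) '' {w | N *ᵥ w = 0}) := by
  classical
  obtain ⟨h, h0, I, v, hv, hs⟩ := hasGenericBasis_of_finite (U := U) (n := n)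
    ((ι → MvPolynomial (Fin n) U) ⧸ LinearMap.range N.mulVecLin)
  choose w hw using fun i => Submodule.Quotient.mk_surjective _ (v i)
  refine ⟨h, h0, fun F _ φ hφ hh z hz => ?_⟩
  have decomp : ∀ y : ι → MvPolynomial (Fin n) U, ∃ (e : ℕ) (x : κ → MvPolynomial (Fin n) U)
      (c : I →₀ U), h ^ e • y = N *ᵥ x + Finsupp.linearCombination U w c := by
    intro y
    obtain ⟨e, he⟩ := hs (Submodule.Quotient.mk y)
    rw [Finsupp.mem_span_range_iff_exists_finsupp] at he
    obtain ⟨c, hc⟩ := he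
    have : Submodule.Quotient.mk (p := LinearMap.range N.mulVecLin) (h ^ e • y) =
        Submodule.Quotient.mk (Finsupp.linearCombination U w c) := by
      rw [Submodule.Quotient.mk_smul, ← hc]
      change _ = (Submodule.mkQ _).restrictScalars U _
      rw [Finsupp.apply_linearCombination, Finsupp.linearCombination_apply]
      refine Finsupp.sum_congr fun i _ => ?_
      rw [← hw]
      rfl
    obtain ⟨x, hx⟩ := (Submodule.Quotient.eq _).1 this
    exact ⟨e, x, c, by rw [← sub_eq_iff_eq_add, ← hx, Matrix.mulVecLin_apply]⟩
  let G : (ι → MvPolynomial (Fin n) U) → Prop := fun y =>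
    ∃ (e : ℕ) (x : κ → MvPolynomial (Fin n) U) (c : I →₀ U), map φ ∘ x = 0 ∧
      h ^ e • y = N *ᵥ x + Finsupp.linearCombination U w c
  have G_zero : G 0 := ⟨0, 0, 0, by ext; simp, by simp⟩
  have G_add : ∀ y y', G y → G y' → G (y + y') := by
    rintro y y' ⟨e, x, c, hx, h1⟩ ⟨e', x', c', hx', h1'⟩
    refine ⟨e + e', h ^ e' • x + h ^ e • x', h ^ e' • c + h ^ e • c', ?_, ?_⟩
    · funext i
      have := congrFun hx i
      have := congrFun hx' i
      simp_all [smul_eq_C_mul]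
    · rw [Matrix.mulVec_add, Matrix.mulVec_smul, Matrix.mulVec_smul, map_add, map_smul, map_smul,
        add_add_add_comm, ← smul_add, ← smul_add, ← h1, ← h1', smul_add, smul_smul, smul_smul,
        ← pow_add, ← pow_add, add_comm e']
  have G_smul : ∀ (a : U) y, φ a = 0 → G (a • y) := by
    intro a y ha
    obtain ⟨e, x, c, h1⟩ := decomp y
    refine ⟨e, a • x, a • c, ?_, ?_⟩
    · funext i
      simp [smul_eq_C_mul, ha]
    · rw [smul_comm, h1, Matrix.mulVec_smul, map_smul, smul_add]
  have G_of_map : ∀ y : ι → MvPolynomial (Fin n) U, map φ ∘ y = 0 → G y := by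
    intro y hy
    have hdec : y = ∑ i, ∑ d ∈ (y i).support,
        coeff d (y i) • Pi.single (M := fun _ => MvPolynomial (Fin n) U) i (monomial d 1) := by
      conv_lhs => rw [← Finset.univ_sum_single y]
      refine Finset.sum_congr rfl fun i _ => ?_
      conv_lhs => rw [(y i).as_sum]
      simp only [← Pi.single_smul, smul_monomial, smul_eq_mul, mul_one]
      exact map_sum (AddMonoidHom.single (fun _ => MvPolynomial (Fin n) U) i) _ _
    rw [hdec]
    refine Finset.sum_induction _ G G_add G_zero fun i _ =>
      Finset.sum_induction _ G G_add G_zero fun d _ => G_smul _ _ ?_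
    have := congrArg (coeff d) (congrFun hy i)
    rwa [Function.comp_apply, coeff_map, Pi.zero_apply, coeff_zero] at this
  obtain ⟨_, ⟨b, hb, rfl⟩, p, hp⟩ := exists_common_denom
    (((nonZeroDivisors F).comap φ).map (C : U →+* MvPolynomial (Fin n) U)) (map φ) z fun i => by
      obtain ⟨b, p, hb, h⟩ := exists_C_mul_eq_map φ hφ (z i)
      exact ⟨C b, ⟨b, mem_nonZeroDivisors_of_ne_zero hb, rfl⟩, p, by rw [map_C, h]⟩
  replace hb : φ b ≠ 0 := nonZeroDivisors.ne_zero hb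
  simp only [map_C] at hp
  have hpz : map φ ∘ p = (C (φ b) : MvPolynomial (Fin n) F) • z :=
    _root_.funext fun i => (hp i).symm
  obtain ⟨e, x, c, hx, hc⟩ := G_of_map (N *ᵥ p) (by
    rw [← map_mulVec_comp, hpz, Matrix.mulVec_smul, hz, smul_zero])
  have hc0 : c = 0 := by
    refine linearIndependent_iff.1 hv c ?_
    have h1 : Finsupp.linearCombination U w c ∈ LinearMap.range N.mulVecLin :=
      ⟨h ^ e • p - x, by
        rw [Matrix.mulVecLin_apply, Matrix.mulVec_sub, Matrix.mulVec_smul, hc, add_sub_cancel_left]⟩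
    rw [← (Submodule.Quotient.mk_eq_zero (LinearMap.range N.mulVecLin)).2 h1]
    change _ = (Submodule.mkQ _).restrictScalars U _
    rw [Finsupp.apply_linearCombination, Finsupp.linearCombination_apply]
    refine Finsupp.sum_congr fun i _ => ?_
    rw [← hw]
    rfl
  have hker : N *ᵥ (h ^ e • p - x) = 0 := by
    rw [Matrix.mulVec_sub, Matrix.mulVec_smul, hc, hc0, map_zero, add_zero, sub_self]
  have hu : φ h ^ e * φ b ≠ 0 := mul_ne_zero (pow_ne_zero _ hh) hb
  have hzw : z = (C (φ h ^ e * φ b)⁻¹ : MvPolynomial (Fin n) F) • (map φ ∘ (h ^ e • p - x)) := by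
    have h1 : map φ ∘ (h ^ e • p - x) = (C (φ h ^ e * φ b) : MvPolynomial (Fin n) F) • z := by
      funext i
      have h2 := congrFun hx i
      have h3 := congrFun hpz i
      simp only [Function.comp_apply, Pi.zero_apply, Pi.smul_apply, smul_eq_mul] at h2 h3
      simp only [Function.comp_apply, Pi.sub_apply, Pi.smul_apply, map_sub, h2, sub_zero,
        smul_eq_C_mul, map_mul, map_pow, map_C, h3, smul_eq_mul, mul_assoc]
    rw [h1, smul_smul, ← C_mul, inv_mul_cancel₀ hu, C_1, one_smul]
  rw [hzw]
  exact Submodule.smul_mem _ _ (Submodule.subset_span ⟨_, hker, rfl⟩)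

theorem AlmostAll.mono {K : Type} [Field K] {m : ℕ} {Q Q' : (Fin m → K) → Prop}
    (H : AlmostAll K m Q) (hQ : ∀ α, Q α → Q' α) : AlmostAll K m Q' := by
  obtain ⟨c, hc, h⟩ := H
  exact ⟨c, hc, fun α hα => hQ α (h α hα)⟩

theorem AlmostAll.forall_finite {K ι : Type} [Field K] {m : ℕ} [Finite ι]
    {Q : ι → (Fin m → K) → Prop} (H : ∀ i, AlmostAll K m (Q i)) :
    AlmostAll K m fun α => ∀ i, Q i α := by
  have := Fintype.ofFinite ι
  choose c hc h using H
  refine ⟨∏ i, c i, Finset.prod_ne_zero_iff.2 fun i _ => hc i, fun α hα i => h i α ?_⟩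
  rw [map_prod] at hα
  exact Finset.prod_ne_zero_iff.1 hα i (Finset.mem_univ i)

theorem AlmostAll.and {K : Type} [Field K] {m : ℕ} {Q Q' : (Fin m → K) → Prop}
    (H : AlmostAll K m Q) (H' : AlmostAll K m Q') : AlmostAll K m fun α => Q α ∧ Q' α := by
  obtain ⟨c, hc, h⟩ := H
  obtain ⟨c', hc', h'⟩ := H'
  refine ⟨c * c', mul_ne_zero hc hc', fun α hα => ?_⟩
  rw [map_mul] at hα
  exact ⟨h α (left_ne_zero_of_mul hα), h' α (right_ne_zero_of_mul hα)⟩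

section Specialization

variable (k K : Type) [Field k] [Field K] [Algebra k K]

theorem coe_evalα {m : ℕ} (α : Fin m → K) (p : MvPolynomial (Fin m) k) :
    (evalα k K α p : K) = aeval α p := by
  change (kA k K α).val (aeval _ p) = _
  rw [comp_aeval_apply]
  rfl

theorem almostAll_evalα_ne_zero {m : ℕ} {h : MvPolynomial (Fin m) k} (h0 : h ≠ 0) :
    AlmostAll K m fun α => evalα k K α h ≠ 0 := by
  refine ⟨map (algebraMap k K) h,
    (map_ne_zero_iff _ (map_injective _ (algebraMap k K).injective)).2 h0, fun α hα h1 => hα ?_⟩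
  rw [eval_map, ← aeval_def, ← coe_evalα, h1]
  rfl

theorem exists_evalα_mul_eq {m : ℕ} (α : Fin m → K) (x : kA k K α) :
    ∃ a b, evalα k K α b ≠ 0 ∧ evalα k K α b * x = evalα k K α a := by
  obtain ⟨r, s, hx⟩ := (IntermediateField.mem_adjoin_range_iff k α (x : K)).1 x.2
  by_cases hs : aeval α s = 0
  · refine ⟨0, 1, by simp, ?_⟩
    rw [hs, div_zero] at hx
    rw [map_zero, map_one, one_mul]
    exact Subtype.ext hx
  · refine ⟨r, s, fun h => hs ?_, Subtype.ext ?_⟩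
    · rw [← coe_evalα, h]
      rfl
    · change (evalα k K α s : K) * (x : K) = _
      rw [coe_evalα, coe_evalα, hx, mul_div_cancel₀ _ hs]

variable {k} {m n : ℕ}

theorem toR_injective : Function.Injective (toR k m n) :=
  map_injective _ (IsFractionRing.injective _ _)

theorem isUnit_C_algebraMap {q : MvPolynomial (Fin m) k} (hq : q ≠ 0) :
    IsUnit (C (algebraMap (MvPolynomial (Fin m) k) (kU k m) q) : Rg k m n) :=
  (IsUnit.mk0 _ ((map_ne_zero_iff _ (IsFractionRing.injective _ _)).2 hq)).map C

theorem toR_C (q : MvPolynomial (Fin m) k) : toR k m n (C q) = C (algebraMap _ _ q) := map_C _ _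

theorem toRa_C (α : Fin m → K) (q : MvPolynomial (Fin m) k) :
    toRa k K n α (C q) = C (evalα k K α q) := map_C _ _

theorem exists_C_mul_eq_toR (f : Rg k m n) :
    ∃ q : MvPolynomial (Fin m) k, q ≠ 0 ∧ ∃ p, C (algebraMap _ _ q) * f = toR k m n p := by
  obtain ⟨b, p, hb, h⟩ := exists_C_mul_eq_map (algebraMap (MvPolynomial (Fin m) k) (kU k m))
    (fun x => by
      obtain ⟨⟨a, b⟩, h⟩ := IsLocalization.surj (nonZeroDivisors (MvPolynomial (Fin m) k)) x
      exact ⟨a, b, (map_ne_zero_iff _ (IsFractionRing.injective _ _)).2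
        (nonZeroDivisors.ne_zero b.2), by rw [mul_comm, h]⟩) f
  exact ⟨b, fun h => hb (by rw [h, map_zero]), p, h⟩

theorem idealSpec_eq_map (α : Fin m → K) (P : Ideal (Rg k m n)) :
    idealSpec k K n α P = (P.comap (toR k m n)).map (toRa k K n α) := rfl

theorem almostAll_toRa_notMem_associatedPrime (P : Ideal (Rg k m n)) [P.IsPrime]
    {d : MvPolynomial (Fin n) (MvPolynomial (Fin m) k)} (hd : toR k m n d ∉ P) :
    AlmostAll K m fun α => ∀ ℘ : Ideal (Ra k K n α),
      IsAssociatedPrime ℘ (Ra k K n α ⧸ idealSpec k K n α P) → toRa k K n α d ∉ ℘ := by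
  obtain ⟨s, p, hp⟩ := Submodule.fg_iff_exists_fin_generating_family.1
    (IsNoetherian.noetherian (P.comap (toR k m n)))
  obtain ⟨h, h0, H⟩ := exists_ker_specialization
    (fun (_ : Unit) (o : Option (Fin s)) => o.elim d p :
      Matrix Unit (Option (Fin s)) (MvPolynomial (Fin n) (MvPolynomial (Fin m) k)))
  refine (almostAll_evalα_ne_zero k K h0).mono fun α hα ℘ h℘ hdα => ?_
  obtain ⟨hprime, x, hx⟩ := isAssociatedPrime_iff.1 h℘
  obtain ⟨x, rfl⟩ := Ideal.Quotient.mk_surjective x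
  have hx0 : x ∉ idealSpec k K n α P := by
    intro hx1
    refine hprime.ne_top ?_
    rw [hx, Ideal.Quotient.eq_zero_iff_mem.2 hx1]
    simp
  rw [hx, Submodule.mem_colon_singleton, Submodule.mem_bot] at hdα
  have hdx : toRa k K n α d * x ∈ idealSpec k K n α P := by
    rw [← Ideal.Quotient.eq_zero_iff_mem]
    exact hdα
  rw [idealSpec_eq_map, ← hp, ← Ideal.span, Ideal.map_span, ← Set.range_comp,
    Ideal.mem_span_range_iff_exists_fun] at hdx
  obtain ⟨c, hc⟩ := hdx
  have hz := H _ (evalα k K α) (exists_evalα_mul_eq k K α) hα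
    (fun o => o.elim x (fun i => -c i)) (by
    funext i
    simp only [Matrix.mulVec, dotProduct, Fintype.sum_option, Option.elim]
    change toRa k K n α d * x + ∑ i, toRa k K n α (p i) * (-c i) = 0
    rw [← hc, ← Finset.sum_add_distrib]
    refine Finset.sum_eq_zero fun i _ => ?_
    rw [Function.comp_apply]
    ring)
  have hmem : ∀ z ∈ Submodule.span (Ra k K n α) ((toRa k K n α ∘ ·) ''
      {w | (fun (_ : Unit) (o : Option (Fin s)) => o.elim d p : Matrix _ _ _) *ᵥ w = 0}),
      z none ∈ idealSpec k K n α P := by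
    intro z hz
    refine Submodule.span_induction ?_ (zero_mem _) (fun _ _ _ _ => add_mem)
      (fun a _ _ => Ideal.mul_mem_left _ a) hz
    rintro _ ⟨w, hw, rfl⟩
    refine Ideal.subset_span ⟨w none, ?_, rfl⟩
    have h1 : d * w none + ∑ i, p i * w (some i) = 0 := by
      have := congrFun hw ()
      simpa [Matrix.mulVec, dotProduct] using! this
    have h2 : d * w none ∈ P.comap (toR k m n) := by
      rw [eq_neg_of_add_eq_zero_left h1]
      refine neg_mem (sum_mem fun i _ => Ideal.mul_mem_right _ _ ?_)
      rw [← hp]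
      exact Submodule.subset_span ⟨i, rfl⟩
    rw [Ideal.mem_comap, map_mul] at h2
    exact (Ideal.IsPrime.mem_or_mem ‹_› h2).resolve_left hd
  exact hx0 (hmem _ hz)

/-- For almost all `α`, the localization of `R_α` at every associated prime of `P_α` satisfies `Q`,
as a ring equipped with the substitution map from `k[u][X]`. -/
def AlmostAllLoc (P : Ideal (Rg k m n)) (Q : ∀ (T : Type) [CommRing T],
    (MvPolynomial (Fin n) (MvPolynomial (Fin m) k) →+* T) → Prop) : Prop :=
  AlmostAll K m fun α => ∀ (℘ : Ideal (Ra k K n α))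
    (h℘ : IsAssociatedPrime ℘ (Ra k K n α ⧸ idealSpec k K n α P)),
    haveI := h℘.isPrime
    ∀ (Sα : Type) [CommRing Sα] [Algebra (Ra k K n α) Sα] [IsLocalization.AtPrime Sα ℘],
      Q Sα ((algebraMap (Ra k K n α) Sα).comp (toRa k K n α))

variable {K} {P : Ideal (Rg k m n)}

theorem AlmostAllLoc.mono {Q Q' : ∀ (T : Type) [CommRing T],
    (MvPolynomial (Fin n) (MvPolynomial (Fin m) k) →+* T) → Prop} (H : AlmostAllLoc K P Q)
    (hQ : ∀ (T : Type) [CommRing T] ψ, Q T ψ → Q' T ψ) : AlmostAllLoc K P Q' :=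
  AlmostAll.mono H fun _ h ℘ h℘ Sα _ _ _ => hQ _ _ (h ℘ h℘ Sα)

theorem AlmostAllLoc.and {Q Q' : ∀ (T : Type) [CommRing T],
    (MvPolynomial (Fin n) (MvPolynomial (Fin m) k) →+* T) → Prop} (H : AlmostAllLoc K P Q)
    (H' : AlmostAllLoc K P Q') : AlmostAllLoc K P fun T _ ψ => Q T ψ ∧ Q' T ψ :=
  (AlmostAll.and H H').mono fun _ h ℘ h℘ Sα _ _ _ => ⟨h.1 ℘ h℘ Sα, h.2 ℘ h℘ Sα⟩

theorem AlmostAllLoc.forall_finite {ι : Type} [Finite ι] {Q : ι → ∀ (T : Type) [CommRing T],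
    (MvPolynomial (Fin n) (MvPolynomial (Fin m) k) →+* T) → Prop}
    (H : ∀ i, AlmostAllLoc K P (Q i)) : AlmostAllLoc K P fun T _ ψ => ∀ i, Q i T ψ :=
  (AlmostAll.forall_finite H).mono fun _ h ℘ h℘ Sα _ _ _ i => h i ℘ h℘ Sα

theorem almostAllLoc_isUnit [P.IsPrime] {d : MvPolynomial (Fin n) (MvPolynomial (Fin m) k)}
    (hd : toR k m n d ∉ P) : AlmostAllLoc K P fun _ _ ψ => IsUnit (ψ d) := by
  refine (almostAll_toRa_notMem_associatedPrime K P hd).mono fun α h ℘ h℘ => ?_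
  have := h℘.isPrime
  intro Sα _ _ _
  exact IsLocalization.map_units Sα (⟨_, h ℘ h℘⟩ : ℘.primeCompl)

theorem almostAllLoc_ker_le_span {ι κ : Type} [Fintype ι] [Fintype κ]
    (N : Matrix ι κ (MvPolynomial (Fin n) (MvPolynomial (Fin m) k))) :
    AlmostAllLoc K P fun T _ ψ => ∀ z : κ → T, N.map ψ *ᵥ z = 0 →
      z ∈ Submodule.span T ((ψ ∘ ·) '' {w | N *ᵥ w = 0}) := by
  obtain ⟨h, h0, H⟩ := exists_ker_specialization N
  refine (almostAll_evalα_ne_zero k K h0).mono fun α hα ℘ h℘ => ?_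
  have := h℘.isPrime
  intro Sα _ _ _ z hz
  have hinj : Function.Injective (algebraMap (Ra k K n α) Sα) :=
    IsLocalization.injective Sα ℘.primeCompl_le_nonZeroDivisors
  obtain ⟨g, hg, y, hy⟩ := exists_common_denom ℘.primeCompl (algebraMap (Ra k K n α) Sα) z
    fun i => by
      obtain ⟨⟨a, b⟩, h⟩ := IsLocalization.surj ℘.primeCompl (z i)
      exact ⟨b, b.2, a, by rw [mul_comm, h]⟩
  have hg : IsUnit (algebraMap (Ra k K n α) Sα g) :=
    IsLocalization.map_units Sα (⟨g, hg⟩ : ℘.primeCompl)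
  have hyz : algebraMap (Ra k K n α) Sα ∘ y = algebraMap (Ra k K n α) Sα g • z :=
    _root_.funext fun i => (hy i).symm
  have hNy : N.map (toRa k K n α) *ᵥ y = 0 := by
    have h1 : (N.map (toRa k K n α)).map (algebraMap (Ra k K n α) Sα) *ᵥ
        (algebraMap (Ra k K n α) Sα ∘ y) = 0 := by
      rw [hyz, Matrix.mulVec_smul, Matrix.map_map]
      exact (congrArg _ hz).trans (smul_zero _)
    rw [map_mulVec_comp] at h1
    funext i
    exact hinj ((congrFun h1 i).trans (map_zero _).symm)
  have hmem := H _ (evalα k K α) (exists_evalα_mul_eq k K α) hα y hNy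
  have hmem' : algebraMap (Ra k K n α) Sα ∘ y ∈ Submodule.span Sα
      ((((algebraMap (Ra k K n α) Sα).comp (toRa k K n α)) ∘ ·) '' {w | N *ᵥ w = 0}) := by
    refine Submodule.span_induction (p := fun y _ => algebraMap (Ra k K n α) Sα ∘ y ∈
      Submodule.span Sα ((((algebraMap (Ra k K n α) Sα).comp (toRa k K n α)) ∘ ·) ''
        {w | N *ᵥ w = 0})) ?_ ?_ ?_ ?_ hmem
    · rintro _ ⟨w, hw, rfl⟩
      exact Submodule.subset_span ⟨w, hw, rfl⟩
    · convert zero_mem (Submodule.span Sα _)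
      ext
      simp
    · intro a b _ _ ha hb
      convert add_mem ha hb
      ext
      simp
    · intro c a _ ha
      convert Submodule.smul_mem _ (algebraMap (Ra k K n α) Sα c) ha
      ext
      simp
  rw [hyz] at hmem'
  exact (Submodule.smul_mem_iff_of_isUnit _ hg).1 hmem'

/-- `b` is a specialization of the fraction `a`: both are the same fraction `p / d` with
`d` invertible in `T`. -/
def FracSpec {A S T : Type} [CommRing A] [CommRing S] [CommRing T] (j : A →+* S) (ψ : A →+* T)
    (a : S) (b : T) : Prop :=
  ∃ p d, IsUnit (ψ d) ∧ j d * a = j p ∧ ψ d * b = ψ p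

section FracSpec

variable {A S T : Type} [CommRing A] [CommRing S] [CommRing T] {j : A →+* S} {ψ : A →+* T}

theorem FracSpec.map_mul_eq (hj : Function.Injective j) {a : S} {b : T} (h : FracSpec j ψ a b)
    {p d : A} (hp : j d * a = j p) : ψ d * b = ψ p := by
  obtain ⟨p', d', hu, h1, h2⟩ := h
  have h3 : d * p' = d' * p := hj (by rw [map_mul, map_mul, ← h1, ← hp]; ring)
  refine hu.mul_left_cancel ?_
  rw [← map_mul ψ d' p, ← h3, map_mul, ← h2]
  ring

theorem fracSpec_zero : FracSpec j ψ 0 0 := ⟨0, 1, by simp, by simp, by simp⟩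

theorem fracSpec_one : FracSpec j ψ 1 1 := ⟨1, 1, by simp, by simp, by simp⟩

theorem FracSpec.mul {a a' : S} {b b' : T} (h : FracSpec j ψ a b) (h' : FracSpec j ψ a' b') :
    FracSpec j ψ (a * a') (b * b') := by
  obtain ⟨p, d, hu, h1, h2⟩ := h
  obtain ⟨p', d', hu', h1', h2'⟩ := h'
  refine ⟨p * p', d * d', by rw [map_mul]; exact hu.mul hu', ?_, ?_⟩
  · rw [map_mul, map_mul, ← h1, ← h1']
    ring
  · rw [map_mul, map_mul, ← h2, ← h2']
    ring

variable {ι κ κ' : Type}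

variable (j ψ) in
/-- Entrywise specialization of matrices of fractions. -/
def MatFracSpec (N : Matrix ι κ S) (N' : Matrix ι κ T) : Prop :=
  ∀ i i', FracSpec j ψ (N i i') (N' i i')

theorem matFracSpec_zero : MatFracSpec j ψ (0 : Matrix ι κ S) 0 := fun _ _ => fracSpec_zero

theorem matFracSpec_one [DecidableEq ι] : MatFracSpec j ψ (1 : Matrix ι ι S) 1 := by
  intro i i'
  rw [Matrix.one_apply, Matrix.one_apply]
  split_ifs
  · exact fracSpec_one
  · exact fracSpec_zero

theorem MatFracSpec.fromCols {N : Matrix ι κ S} {N' : Matrix ι κ T} {M : Matrix ι κ' S}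
    {M' : Matrix ι κ' T} (h : MatFracSpec j ψ N N') (h' : MatFracSpec j ψ M M') :
    MatFracSpec j ψ (Matrix.fromCols N M) (Matrix.fromCols N' M')
  | i, .inl c => h i c
  | i, .inr c => h' i c

theorem MatFracSpec.smul {a : S} {b : T} (ha : FracSpec j ψ a b) {N : Matrix ι κ S}
    {N' : Matrix ι κ T} (h : MatFracSpec j ψ N N') : MatFracSpec j ψ (a • N) (b • N') :=
  fun i i' => ha.mul (h i i')

end FracSpec

variable [P.IsPrime] {S : Type} [CommRing S] [Algebra (Rg k m n) S] [IsLocalization.AtPrime S P]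

theorem LocElemSpec.fracSpec {α : Fin m → K} {℘ : Ideal (Ra k K n α)} [℘.IsPrime]
    {Sα : Type} [CommRing Sα] [Algebra (Ra k K n α) Sα] [IsLocalization.AtPrime Sα ℘]
    {a : S} {aα : Sα} (h : LocElemSpec P ℘ a aα) :
    FracSpec ((algebraMap (Rg k m n) S).comp (toR k m n))
      ((algebraMap (Ra k K n α) Sα).comp (toRa k K n α)) a aα := by
  obtain ⟨f, g, fα, gα, hg, hgα, ⟨p, q, hq, hp, hpα⟩, ⟨p', q', hq', hp', hpα'⟩, ha, haα⟩ := h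
  rw [eq_comm, IsLocalization.mk'_eq_iff_eq_mul] at ha haα
  have hunit : ∀ x : MvPolynomial (Fin m) k, evalα k K α x ≠ 0 →
      IsUnit (algebraMap (Ra k K n α) Sα (C (evalα k K α x))) := fun x hx =>
    ((IsUnit.mk0 _ hx).map C).map _
  refine ⟨p * C q', C q * p', ?_, ?_, ?_⟩
  · rw [RingHom.comp_apply, map_mul, map_mul, toRa_C, ← hpα', map_mul]
    exact (hunit q hq).mul ((hunit q' hq').mul
      (IsLocalization.map_units Sα (⟨gα, hgα⟩ : ℘.primeCompl)))
  · simp only [RingHom.comp_apply, map_mul, toR_C, ← hp, ← hp', ha]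
    ring
  · simp only [RingHom.comp_apply, map_mul, toRa_C, ← hpα, ← hpα', haα]
    ring

theorem algebraMap_comp_toR_injective (P : Ideal (Rg k m n)) [P.IsPrime]
    [IsLocalization.AtPrime S P] :
    Function.Injective ((algebraMap (Rg k m n) S).comp (toR k m n)) :=
  (IsLocalization.injective S P.primeCompl_le_nonZeroDivisors).comp toR_injective

theorem exists_denom (P : Ideal (Rg k m n)) [P.IsPrime] [IsLocalization.AtPrime S P] (x : S) :
    ∃ d ∈ P.primeCompl.comap (toR k m n), ∃ p,
      (algebraMap (Rg k m n) S).comp (toR k m n) d * x =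
        (algebraMap (Rg k m n) S).comp (toR k m n) p := by
  obtain ⟨⟨f, g⟩, h⟩ := IsLocalization.surj P.primeCompl x
  obtain ⟨q, hq, p, hp⟩ := exists_C_mul_eq_toR f
  obtain ⟨q', hq', p', hp'⟩ := exists_C_mul_eq_toR (g : Rg k m n)
  refine ⟨C q * p', ?_, C q' * p, ?_⟩
  · change toR k m n (C q * p') ∉ P
    rw [map_mul, toR_C, ← hp', Ideal.unit_mul_mem_iff_mem _ (isUnit_C_algebraMap hq),
      Ideal.unit_mul_mem_iff_mem _ (isUnit_C_algebraMap hq')]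
    exact g.2
  · simp only [RingHom.comp_apply, map_mul, toR_C, ← hp, ← hp', ← h]
    ring

theorem almostAllLoc_map_mulVec_mem_range {ι κ μ ν : Type} [Fintype ι] [Fintype κ] [Fintype ν]
    (N : Matrix ι κ (MvPolynomial (Fin n) (MvPolynomial (Fin m) k)))
    (V : Matrix μ κ (MvPolynomial (Fin n) (MvPolynomial (Fin m) k)))
    (W : Matrix μ ν (MvPolynomial (Fin n) (MvPolynomial (Fin m) k)))
    (H : ∀ x, N.map ((algebraMap (Rg k m n) S).comp (toR k m n)) *ᵥ x = 0 →
      ∃ y, W.map ((algebraMap (Rg k m n) S).comp (toR k m n)) *ᵥ y =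
        V.map ((algebraMap (Rg k m n) S).comp (toR k m n)) *ᵥ x) :
    AlmostAllLoc K P fun T _ ψ => ∀ x : κ → T, N.map ψ *ᵥ x = 0 →
      ∃ y, W.map ψ *ᵥ y = V.map ψ *ᵥ x := by
  obtain ⟨s, w, hw⟩ := Submodule.fg_iff_exists_fin_generating_family.1
    (IsNoetherian.noetherian (LinearMap.ker N.mulVecLin))
  have hinj := algebraMap_comp_toR_injective (S := S) P
  have hden := exists_denom (S := S) P
  set j := (algebraMap (Rg k m n) S).comp (toR k m n)
  have hgen : ∀ l, ∃ y, W.map j *ᵥ y = V.map j *ᵥ (j ∘ w l) := by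
    intro l
    refine H _ ?_
    have : N *ᵥ w l = 0 := by
      have : w l ∈ LinearMap.ker N.mulVecLin := hw ▸ Submodule.subset_span ⟨l, rfl⟩
      exact this
    rw [map_mulVec_comp, this]
    ext
    simp
  choose y hy using hgen
  obtain ⟨d, hd, z, hz⟩ := exists_common_denom (P.primeCompl.comap (toR k m n)) j
    (fun p : Fin s × ν => y p.1 p.2) fun p => hden _
  have hWz : ∀ l, W *ᵥ (fun i => z (l, i)) = d • V *ᵥ w l := by
    intro l
    have : W.map j *ᵥ (j ∘ fun i => z (l, i)) = j d • V.map j *ᵥ (j ∘ w l) := by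
      rw [← hy, ← Matrix.mulVec_smul]
      congr 1
      exact _root_.funext fun i => (hz (l, i)).symm
    rw [map_mulVec_comp, map_mulVec_comp] at this
    funext i
    refine hinj ((congrFun this i).trans ?_)
    simp
  have hker : ∀ x, N *ᵥ x = 0 → ∃ y, W *ᵥ y = d • V *ᵥ x := by
    intro x hx
    have : LinearMap.ker N.mulVecLin ≤
        (LinearMap.range W.mulVecLin).comap (d • V.mulVecLin) := by
      rw [← hw, Submodule.span_le]
      rintro _ ⟨l, rfl⟩
      exact ⟨_, hWz l⟩
    exact this hx
  refine ((almostAllLoc_isUnit hd).and (almostAllLoc_ker_le_span N)).mono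
    fun T _ ψ ⟨hu, h⟩ x hx => ?_
  have : Submodule.span T ((ψ ∘ ·) '' {w | N *ᵥ w = 0}) ≤
      (LinearMap.range (W.map ψ).mulVecLin).comap (V.map ψ).mulVecLin := by
    rw [Submodule.span_le]
    rintro _ ⟨w, hw, rfl⟩
    obtain ⟨y, hy⟩ := hker w hw
    change V.map ψ *ᵥ (ψ ∘ w) ∈ LinearMap.range (W.map ψ).mulVecLin
    refine (Submodule.smul_mem_iff_of_isUnit _ hu).1 ⟨ψ ∘ y, ?_⟩
    rw [Matrix.mulVecLin_apply, map_mulVec_comp, map_mulVec_comp, hy]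
    ext
    simp
  exact this (h x hx)

theorem almostAllLoc_mulVec_mem_range {ι κ μ ν : Type} [Fintype ι] [Fintype κ] [Fintype μ]
    [Fintype ν] (N : Matrix ι κ S) (V : Matrix μ κ S) (W : Matrix μ ν S)
    (H : ∀ x, N *ᵥ x = 0 → ∃ y, W *ᵥ y = V *ᵥ x) :
    AlmostAllLoc K P fun T _ ψ => ∀ (N' : Matrix ι κ T) (V' : Matrix μ κ T) (W' : Matrix μ ν T),
      MatFracSpec ((algebraMap (Rg k m n) S).comp (toR k m n)) ψ N N' →
      MatFracSpec ((algebraMap (Rg k m n) S).comp (toR k m n)) ψ V V' →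
      MatFracSpec ((algebraMap (Rg k m n) S).comp (toR k m n)) ψ W W' →
      ∀ x : κ → T, N' *ᵥ x = 0 → ∃ y, W' *ᵥ y = V' *ᵥ x := by
  have hinj := algebraMap_comp_toR_injective (S := S) P
  have hden := exists_denom (S := S) P
  have hunit : ∀ d ∈ P.primeCompl.comap (toR k m n),
      IsUnit ((algebraMap (Rg k m n) S).comp (toR k m n) d) := fun d hd =>
    IsLocalization.map_units S (⟨_, hd⟩ : P.primeCompl)
  have key := almostAllLoc_map_mulVec_mem_range (K := K) (P := P) (S := S) (ι := ι) (κ := κ)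
    (μ := μ) (ν := ν)
  set j := (algebraMap (Rg k m n) S).comp (toR k m n)
  obtain ⟨d, hd, z, hz⟩ := exists_common_denom (P.primeCompl.comap (toR k m n)) j
    (Sum.elim (fun p : ι × κ => N p.1 p.2)
      (Sum.elim (fun p : μ × κ => V p.1 p.2) fun p : μ × ν => W p.1 p.2)) fun p => hden _
  let N₀ : Matrix ι κ _ := fun i i' => z (.inl (i, i'))
  let V₀ : Matrix μ κ _ := fun i i' => z (.inr (.inl (i, i')))
  let W₀ : Matrix μ ν _ := fun i i' => z (.inr (.inr (i, i')))
  have hN : N₀.map j = j d • N := Matrix.ext fun i i' => (hz (.inl (i, i'))).symm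
  have hV : V₀.map j = j d • V := Matrix.ext fun i i' => (hz (.inr (.inl (i, i')))).symm
  have hW : W₀.map j = j d • W := Matrix.ext fun i i' => (hz (.inr (.inr (i, i')))).symm
  refine ((almostAllLoc_isUnit hd).and (key N₀ V₀ W₀ ?_)).mono ?_
  · intro x hx
    rw [hN, Matrix.smul_mulVec, (hunit d hd).smul_eq_zero] at hx
    obtain ⟨y, hy⟩ := H x hx
    exact ⟨y, by rw [hW, hV, Matrix.smul_mulVec, Matrix.smul_mulVec, hy]⟩
  · rintro T _ ψ ⟨hu, h⟩ N' V' W' hN' hV' hW' x hx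
    have hN₁ : N₀.map ψ = ψ d • N' := Matrix.ext fun i i' =>
      ((hN' i i').map_mul_eq hinj (hz (.inl (i, i')))).symm
    have hV₁ : V₀.map ψ = ψ d • V' := Matrix.ext fun i i' =>
      ((hV' i i').map_mul_eq hinj (hz (.inr (.inl (i, i'))))).symm
    have hW₁ : W₀.map ψ = ψ d • W' := Matrix.ext fun i i' =>
      ((hW' i i').map_mul_eq hinj (hz (.inr (.inr (i, i'))))).symm
    obtain ⟨y, hy⟩ := h x (by rw [hN₁, Matrix.smul_mulVec, hx, smul_zero])
    rw [hW₁, hV₁, Matrix.smul_mulVec, Matrix.smul_mulVec] at hy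
    exact ⟨y, hu.smul_left_cancel.1 hy⟩

end Specialization

section Matrix

variable {T ι τ κ : Type} [CommRing T]

/-- The matrix of `x ↦ (a i • x) i`. -/
def smulCol (ι : Type) [DecidableEq ι] (a : τ → T) : Matrix (τ × ι) ι T :=
  Matrix.of fun p r => a p.1 * (1 : Matrix ι ι T) p.2 r

/-- The block diagonal matrix with `τ` diagonal blocks equal to `C`. -/
def diagBlock (τ : Type) [DecidableEq τ] (C : Matrix ι κ T) : Matrix (τ × ι) (τ × κ) T :=
  Matrix.of fun p q => (1 : Matrix τ τ T) p.1 q.1 * C p.2 q.2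

theorem smulCol_mulVec [Fintype ι] [DecidableEq ι] (a : τ → T) (x : ι → T) :
    smulCol ι a *ᵥ x = fun p => a p.1 * x p.2 := by
  ext p
  simp [smulCol, Matrix.mulVec, dotProduct, Matrix.one_apply]

theorem diagBlock_mulVec [Fintype τ] [DecidableEq τ] [Fintype κ] (C : Matrix ι κ T)
    (y : τ × κ → T) :
    diagBlock τ C *ᵥ y = fun p => (C *ᵥ fun s => y (p.1, s)) p.2 := by
  ext p
  simp [diagBlock, Matrix.mulVec, dotProduct, Matrix.one_apply, Fintype.sum_prod_type, ite_mul]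

theorem smulCol_transpose_mulVec [Fintype ι] [DecidableEq ι] [Fintype τ] (a : τ → T)
    (l : τ × ι → T) :
    (smulCol ι a)ᵀ *ᵥ l = ∑ i, a i • fun r => l (i, r) := by
  ext r
  simp [smulCol, Matrix.mulVec, dotProduct, Matrix.one_apply, Fintype.sum_prod_type]

end Matrix

section Transfer

variable {ι κ κ' κ'' τ : Type}

section FracSpec

variable {A S T : Type} [CommRing A] [CommRing S] [CommRing T] {j : A →+* S} {ψ : A →+* T}

theorem matFracSpec_smulCol [DecidableEq ι] {a : τ → S} {b : τ → T}
    (h : ∀ i, FracSpec j ψ (a i) (b i)) :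
    MatFracSpec j ψ (smulCol ι a) (smulCol ι b) :=
  fun p r => (h p.1).mul (matFracSpec_one p.2 r)

theorem MatFracSpec.diagBlock [DecidableEq τ] {C : Matrix ι κ S} {C' : Matrix ι κ T}
    (h : MatFracSpec j ψ C C') :
    MatFracSpec j ψ (diagBlock τ C) (diagBlock τ C') :=
  fun p q => (matFracSpec_one p.1 q.1).mul (h p.2 q.2)

end FracSpec

variable [Fintype ι] [Fintype κ] [Fintype κ'] {k K : Type} [Field k] [Field K] [Algebra k K]
  {m n : ℕ} {P : Ideal (Rg k m n)}
  [P.IsPrime] {S : Type} [CommRing S] [Algebra (Rg k m n) S] [IsLocalization.AtPrime S P]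

theorem almostAllLoc_of_mulVec_eq_mulVec [Fintype κ''] (A : Matrix κ κ'' S) (V : Matrix ι κ S)
    (C : Matrix ι κ' S) (H : ∀ x z, V *ᵥ x = C *ᵥ z → ∃ y, A *ᵥ y = x) :
    AlmostAllLoc K P fun T _ ψ => ∀ (A' : Matrix κ κ'' T) (V' : Matrix ι κ T) (C' : Matrix ι κ' T),
      MatFracSpec ((algebraMap (Rg k m n) S).comp (toR k m n)) ψ A A' →
      MatFracSpec ((algebraMap (Rg k m n) S).comp (toR k m n)) ψ V V' →
      MatFracSpec ((algebraMap (Rg k m n) S).comp (toR k m n)) ψ C C' →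
      ∀ x z, V' *ᵥ x = C' *ᵥ z → ∃ y, A' *ᵥ y = x := by
  classical
  refine (almostAllLoc_mulVec_mem_range (K := K) (P := P) (Matrix.fromCols V C)
    (Matrix.fromCols 1 0) A fun x hx => ?_).mono fun T _ ψ h A' V' C' hA hV hC x z hxz => ?_
  · rw [← Sum.elim_comp_inl_inr x, Matrix.fromCols_mulVec_sumElim] at hx
    obtain ⟨y, hy⟩ := H (x ∘ .inl) (-(x ∘ .inr))
      (by rw [Matrix.mulVec_neg, eq_neg_of_add_eq_zero_left hx])
    refine ⟨y, ?_⟩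
    rw [← Sum.elim_comp_inl_inr x, Matrix.fromCols_mulVec_sumElim]
    simpa using hy
  · obtain ⟨y, hy⟩ := h (Matrix.fromCols V' C') (Matrix.fromCols 1 0) A' (hV.fromCols hC)
      (matFracSpec_one.fromCols matFracSpec_zero) hA (Sum.elim x (-z))
      (by rw [Matrix.fromCols_mulVec_sumElim, Matrix.mulVec_neg, hxz, add_neg_cancel])
    refine ⟨y, hy.trans ?_⟩
    rw [Matrix.fromCols_mulVec_sumElim]
    simp

theorem almostAllLoc_of_smul_eq_mulVec [Finite τ] (a : τ → S) (V : Matrix ι κ S) (C : Matrix ι κ' S)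
    (H : ∀ (x : ι → S) (y : τ → κ' → S), (∀ i, C *ᵥ y i = a i • x) →
      ∃ w z, V *ᵥ w + C *ᵥ z = x) :
    AlmostAllLoc K P fun T _ ψ => ∀ (b : τ → T) (V' : Matrix ι κ T) (C' : Matrix ι κ' T),
      (∀ i, FracSpec ((algebraMap (Rg k m n) S).comp (toR k m n)) ψ (a i) (b i)) →
      MatFracSpec ((algebraMap (Rg k m n) S).comp (toR k m n)) ψ V V' →
      MatFracSpec ((algebraMap (Rg k m n) S).comp (toR k m n)) ψ C C' →
      ∀ (x : ι → T) (y : τ → κ' → T), (∀ i, C' *ᵥ y i = b i • x) →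
        ∃ w z, V' *ᵥ w + C' *ᵥ z = x := by
  classical
  have := Fintype.ofFinite τ
  refine (almostAllLoc_mulVec_mem_range (K := K) (P := P)
    (Matrix.fromCols (smulCol ι a) (diagBlock τ C)) (Matrix.fromCols 1 0)
    (Matrix.fromCols V C) fun x hx => ?_).mono fun T _ ψ h b V' C' ha hV hC x y hxy => ?_
  · rw [← Sum.elim_comp_inl_inr x, Matrix.fromCols_mulVec_sumElim, smulCol_mulVec,
      diagBlock_mulVec] at hx
    obtain ⟨w, z, hwz⟩ := H (x ∘ .inl) (fun i s => -x (.inr (i, s))) fun i => by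
      funext r
      have := eq_neg_of_add_eq_zero_left (congrFun hx (i, r))
      change (C *ᵥ -fun s => x (.inr (i, s))) r = _
      rw [Matrix.mulVec_neg]
      exact this.symm
    refine ⟨Sum.elim w z, ?_⟩
    rw [← Sum.elim_comp_inl_inr x, Matrix.fromCols_mulVec_sumElim, Matrix.fromCols_mulVec_sumElim]
    simpa using hwz
  · obtain ⟨y, hy⟩ := h (Matrix.fromCols (smulCol ι b) (diagBlock τ C')) (Matrix.fromCols 1 0)
      (Matrix.fromCols V' C') ((matFracSpec_smulCol ha).fromCols hC.diagBlock)
      (matFracSpec_one.fromCols matFracSpec_zero) (hV.fromCols hC)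
      (Sum.elim x (-fun p => y p.1 p.2)) (by
        rw [Matrix.fromCols_mulVec_sumElim, Matrix.mulVec_neg, smulCol_mulVec, diagBlock_mulVec,
          add_neg_eq_zero]
        exact _root_.funext fun p => (congrFun (hxy p.1) p.2).symm)
    refine ⟨y ∘ .inl, y ∘ .inr, ?_⟩
    rw [← Matrix.fromCols_mulVec_sumElim, Sum.elim_comp_inl_inr, hy,
      Matrix.fromCols_mulVec_sumElim]
    simp

theorem almostAllLoc_mulVec_eq_mulVec (W : Matrix ι κ S) (V : Matrix ι κ' S)
    (H : ∀ x, ∃ y, W *ᵥ y = V *ᵥ x) :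
    AlmostAllLoc K P fun T _ ψ => ∀ (W' : Matrix ι κ T) (V' : Matrix ι κ' T),
      MatFracSpec ((algebraMap (Rg k m n) S).comp (toR k m n)) ψ W W' →
      MatFracSpec ((algebraMap (Rg k m n) S).comp (toR k m n)) ψ V V' →
      ∀ x, ∃ y, W' *ᵥ y = V' *ᵥ x :=
  (almostAllLoc_mulVec_mem_range (0 : Matrix Empty κ' S) V W fun x _ => H x).mono
    fun _ _ _ h W' V' hW hV x => h 0 V' W' matFracSpec_zero hV hW x (Matrix.zero_mulVec x)

end Transfer

section Module

variable {T : Type} [CommRing T]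

theorem mem_span_range_smul_top_iff {M : Type} [AddCommGroup M] [Module T M] {τ : Type}
    [Fintype τ] (a : τ → T) (x : M) :
    x ∈ Ideal.span (Set.range a) • (⊤ : Submodule T M) ↔ ∃ l : τ → M, ∑ i, a i • l i = x := by
  constructor
  · intro hx
    refine Submodule.smul_induction_on hx ?_ ?_
    · intro c hc y _
      obtain ⟨d, rfl⟩ := Ideal.mem_span_range_iff_exists_fun.1 hc
      refine ⟨fun i => d i • y, ?_⟩
      rw [Finset.sum_smul]
      exact Finset.sum_congr rfl fun i _ => by rw [smul_smul, mul_comm]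
    · rintro _ _ ⟨l, rfl⟩ ⟨l', rfl⟩
      exact ⟨l + l', by simp [Finset.sum_add_distrib]⟩
  · rintro ⟨l, rfl⟩
    exact sum_mem fun i _ => Submodule.smul_mem_smul (Ideal.subset_span ⟨i, rfl⟩) trivial

theorem mem_colonSubmodule_span_range_iff {M : Type} [AddCommGroup M] [Module T M] {τ : Type}
    (a : τ → T) (x : M) :
    x ∈ colonSubmodule (Ideal.span (Set.range a)) M ↔ ∀ i, a i • x = 0 := by
  refine ⟨fun h i => h _ (Ideal.subset_span ⟨i, rfl⟩), fun h c hc => ?_⟩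
  have : Ideal.span (Set.range a) ≤ LinearMap.ker (LinearMap.toSpanSingleton T M x) := by
    rw [Ideal.span_le]
    rintro _ ⟨i, rfl⟩
    exact h i
  exact this hc

variable {r s r' s' : ℕ} {B : Matrix (Fin r) (Fin s) T} {C : Matrix (Fin r') (Fin s') T}
  {W : Matrix (Fin r') (Fin r) T}
  {h : LinearMap.range B.mulVecLin ≤ (LinearMap.range C.mulVecLin).comap W.mulVecLin}

theorem cokerMap_injective (H : ∀ x z, W *ᵥ x = C *ᵥ z → ∃ y, B *ᵥ y = x) :
    Function.Injective (cokerMap W h) := by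
  rw [injective_iff_map_eq_zero]
  intro x hx
  obtain ⟨x, rfl⟩ := Submodule.Quotient.mk_surjective _ x
  obtain ⟨z, hz⟩ := (Submodule.Quotient.mk_eq_zero _).1 hx
  exact (Submodule.Quotient.mk_eq_zero _).2 (H x z hz.symm)

theorem mk_mem_range_cokerMap_iff (x : Fin r' → T) :
    (Submodule.Quotient.mk x : MatCoker C) ∈ LinearMap.range (cokerMap W h) ↔
      ∃ w z, W *ᵥ w + C *ᵥ z = x := by
  constructor
  · rintro ⟨w, hw⟩
    obtain ⟨w, rfl⟩ := Submodule.Quotient.mk_surjective _ w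
    obtain ⟨z, hz⟩ := (Submodule.Quotient.eq _).1 hw.symm
    refine ⟨w, z, ?_⟩
    rw [← Matrix.mulVecLin_apply C, hz, Matrix.mulVecLin_apply, add_sub_cancel]
  · rintro ⟨w, z, rfl⟩
    refine ⟨Submodule.Quotient.mk w, (Submodule.Quotient.eq _).2 ⟨-z, ?_⟩⟩
    simp [Matrix.mulVec_neg]

theorem range_cokerMap_eq_colonSubmodule {τ : Type} (b : τ → T)
    (H : ∀ (x : Fin r' → T) (y : τ → Fin s' → T), (∀ i, C *ᵥ y i = b i • x) →
      ∃ w z, W *ᵥ w + C *ᵥ z = x) (H' : ∀ i x, ∃ y, C *ᵥ y = (b i • W) *ᵥ x) :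
    LinearMap.range (cokerMap W h) = colonSubmodule (Ideal.span (Set.range b)) (MatCoker C) := by
  ext x
  obtain ⟨x, rfl⟩ := Submodule.Quotient.mk_surjective _ x
  have h0 : ∀ i, b i • (Submodule.Quotient.mk x : MatCoker C) = 0 ↔ ∃ y, C *ᵥ y = b i • x :=
    fun i => Submodule.Quotient.mk_eq_zero _
  rw [mk_mem_range_cokerMap_iff, mem_colonSubmodule_span_range_iff, forall_congr' h0]
  constructor
  · rintro ⟨w, z, rfl⟩ i
    obtain ⟨y, hy⟩ := H' i w
    exact ⟨y + b i • z, by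
      rw [Matrix.mulVec_add, hy, Matrix.smul_mulVec, Matrix.mulVec_smul, smul_add]⟩
  · intro hx
    choose y hy using hx
    exact H x y hy

theorem range_cokerMap_eq_smul_top {τ : Type} [Fintype τ] (b : τ → T)
    (H : ∀ x, ∃ y, Matrix.fromCols (smulCol (Fin r') b)ᵀ C *ᵥ y = W *ᵥ x)
    (H' : ∀ i x, ∃ y, Matrix.fromCols W C *ᵥ y = (b i • (1 : Matrix (Fin r') (Fin r') T)) *ᵥ x) :
    LinearMap.range (cokerMap W h) =
      Ideal.span (Set.range b) • (⊤ : Submodule T (MatCoker C)) := by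
  classical
  apply le_antisymm
  · rintro _ ⟨x, rfl⟩
    obtain ⟨x, rfl⟩ := Submodule.Quotient.mk_surjective _ x
    obtain ⟨y, hy⟩ := H x
    rw [← Sum.elim_comp_inl_inr y, Matrix.fromCols_mulVec_sumElim, smulCol_transpose_mulVec] at hy
    refine (mem_span_range_smul_top_iff _ _).2
      ⟨fun i => Submodule.Quotient.mk fun r => y (.inl (i, r)), ?_⟩
    change _ = Submodule.Quotient.mk (W *ᵥ x)
    rw [← hy]
    change ∑ i, b i • Submodule.mkQ _ (fun r => y (.inl (i, r))) = Submodule.mkQ _ _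
    have hz : Submodule.mkQ (LinearMap.range C.mulVecLin) (C *ᵥ (y ∘ .inr)) = 0 :=
      (Submodule.Quotient.mk_eq_zero _).2 ⟨y ∘ .inr, rfl⟩
    rw [map_add, map_sum, hz, add_zero]
    simp only [map_smul]
    rfl
  · intro x hx
    obtain ⟨l, rfl⟩ := (mem_span_range_smul_top_iff _ _).1 hx
    refine sum_mem fun i _ => ?_
    obtain ⟨x, hx⟩ := Submodule.Quotient.mk_surjective _ (l i)
    obtain ⟨y, hy⟩ := H' i x
    rw [← hx]
    refine (mk_mem_range_cokerMap_iff _).2 ⟨y ∘ .inl, y ∘ .inr, ?_⟩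
    rw [← Matrix.fromCols_mulVec_sumElim, Sum.elim_comp_inl_inr, hy, Matrix.smul_mulVec,
      Matrix.one_mulVec]

end Module

section Present

variable {S : Type} [CommRing S] {L M : Type} [AddCommGroup L] [Module S L] [AddCommGroup M]
  [Module S M] {rL sL rM sM : ℕ} {pL : Present S rL sL L} {pM : Present S rM sM M}

theorem Present.π_eq_zero_iff (pL : Present S rL sL L) (x : Fin rL → S) :
    pL.π x = 0 ↔ ∃ y, pL.A *ᵥ y = x := by
  rw [← LinearMap.mem_ker, pL.ker_eq]
  rfl

theorem MapLift.π_mulVec {v : L →ₗ[S] M} (l : MapLift pL pM v) (x : Fin rL → S) :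
    pM.π (l.V0 *ᵥ x) = v (pL.π x) :=
  LinearMap.congr_fun l.comm0 x

theorem MapLift.exists_mulVec_eq {v : L →ₗ[S] M} (hv : Function.Injective v)
    (l : MapLift pL pM v) (x : Fin rL → S) (z : Fin sM → S) (h : l.V0 *ᵥ x = pM.A *ᵥ z) :
    ∃ y, pL.A *ᵥ y = x := by
  rw [← pL.π_eq_zero_iff]
  refine hv ?_
  rw [← l.π_mulVec, h, map_zero, pM.π_eq_zero_iff]
  exact ⟨z, rfl⟩

theorem MapLift.exists_mulVec_add_eq {v : L →ₗ[S] M} (l : MapLift pL pM v) (x : Fin rM → S)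
    (h : pM.π x ∈ LinearMap.range v) : ∃ w z, l.V0 *ᵥ w + pM.A *ᵥ z = x := by
  obtain ⟨w, hw⟩ := h
  obtain ⟨w, rfl⟩ := pL.surj w
  obtain ⟨z, hz⟩ := (pM.π_eq_zero_iff (x - l.V0 *ᵥ w)).1 (by
    rw [map_sub, l.π_mulVec, hw, sub_self])
  exact ⟨w, z, by rw [hz, add_sub_cancel]⟩

end Present

/-- for a finitely generated `S`-module `L` and an ideal
`𝔞 = (a_1, …, a_t)` of `S`, for almost all `α` one has canonical isomorphisms
`(0 :_L 𝔞)_α ≅ 0 :_{L_α} 𝔞_α` and `(𝔞L)_α ≅ 𝔞_α L_α`: the specializations of the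
inclusions `(0 :_L 𝔞) → L` and `𝔞L → L` are injective, with images
`0 :_{L_α} 𝔞_α` and `𝔞_α L_α` respectively, where `𝔞_α = ((a_1)_α, …, (a_t)_α)`. -/
theorem specialization_of_colon_and_product
    (k K : Type) [Field k] [Field K] [Algebra k K] [Infinite K] {m n : ℕ}
    (P : Ideal (Rg k m n)) [P.IsPrime]
    (S : Type) [CommRing S] [Algebra (Rg k m n) S] [IsLocalization.AtPrime S P]
    (L : Type) [AddCommGroup L] [Module S L] [Module.Finite S L]
    (𝔞 : Ideal S) {t : ℕ} (a : Fin t → S) (ha : Ideal.span (Set.range a) = 𝔞)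
    {rL sL rT sT rU sU : ℕ} (pL : Present S rL sL L)
    (pT : Present S rT sT (colonSubmodule 𝔞 L))
    (pU : Present S rU sU (↥(𝔞 • (⊤ : Submodule S L))))
    (lT : MapLift pT pL (colonSubmodule 𝔞 L).subtype)
    (lU : MapLift pU pL (𝔞 • (⊤ : Submodule S L)).subtype) :
    AlmostAll K m fun α =>
      ∀ (℘ : Ideal (Ra k K n α))
        (h℘ : IsAssociatedPrime ℘ ((Ra k K n α) ⧸ idealSpec k K n α P)),
        haveI := h℘.isPrime
        ∀ (Sα : Type) [CommRing Sα] [Algebra (Ra k K n α) Sα]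
          [IsLocalization.AtPrime Sα ℘]
          (BL : Matrix (Fin rL) (Fin sL) Sα) (BT : Matrix (Fin rT) (Fin sT) Sα)
          (BU : Matrix (Fin rU) (Fin sU) Sα)
          (uT0 : Matrix (Fin rL) (Fin rT) Sα) (uU0 : Matrix (Fin rL) (Fin rU) Sα)
          (b : Fin t → Sα),
          MatSpec (LocElemSpec P ℘) pL.A BL → MatSpec (LocElemSpec P ℘) pT.A BT →
          MatSpec (LocElemSpec P ℘) pU.A BU →
          MatSpec (LocElemSpec P ℘) lT.V0 uT0 → MatSpec (LocElemSpec P ℘) lU.V0 uU0 →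
          (∀ i, LocElemSpec P ℘ (a i) (b i)) →
          (∀ h : LinearMap.range BT.mulVecLin ≤
              (LinearMap.range BL.mulVecLin).comap uT0.mulVecLin,
            Function.Injective (cokerMap uT0 h) ∧
            LinearMap.range (cokerMap uT0 h) =
              colonSubmodule (Ideal.span (Set.range b)) (MatCoker BL)) ∧
          (∀ h : LinearMap.range BU.mulVecLin ≤
              (LinearMap.range BL.mulVecLin).comap uU0.mulVecLin,
            Function.Injective (cokerMap uU0 h) ∧
            LinearMap.range (cokerMap uU0 h) =
              Ideal.span (Set.range b) • (⊤ : Submodule Sα (MatCoker BL))) := by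
  subst ha
  refine AlmostAll.mono (AlmostAllLoc.and
    (AlmostAllLoc.and
      (almostAllLoc_of_mulVec_eq_mulVec (K := K) (P := P) pT.A lT.V0 pL.A
        (lT.exists_mulVec_eq (Submodule.injective_subtype _)))
      (.and (almostAllLoc_of_smul_eq_mulVec (K := K) (P := P) a lT.V0 pL.A ?_)
        (.forall_finite fun i =>
          almostAllLoc_mulVec_eq_mulVec (K := K) (P := P) pL.A (a i • lT.V0) ?_)))
    (AlmostAllLoc.and
      (almostAllLoc_of_mulVec_eq_mulVec (K := K) (P := P) pU.A lU.V0 pL.A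
        (lU.exists_mulVec_eq (Submodule.injective_subtype _)))
      (.and (almostAllLoc_mulVec_eq_mulVec (K := K) (P := P)
          (Matrix.fromCols (smulCol (Fin rL) a)ᵀ pL.A) lU.V0 ?_)
        (.forall_finite fun i => almostAllLoc_mulVec_eq_mulVec (K := K) (P := P)
          (Matrix.fromCols lU.V0 pL.A) (a i • (1 : Matrix (Fin rL) (Fin rL) S)) ?_)))) ?_
  · intro x y hxy
    refine lT.exists_mulVec_add_eq x ?_
    rw [Submodule.range_subtype, mem_colonSubmodule_span_range_iff]
    intro i
    rw [← map_smul, pL.π_eq_zero_iff]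
    exact ⟨y i, hxy i⟩
  · intro x
    rw [← pL.π_eq_zero_iff, Matrix.smul_mulVec, map_smul, lT.π_mulVec]
    exact (pT.π x).2 _ (Ideal.subset_span ⟨i, rfl⟩)
  · intro x
    have hx := (pU.π x).2
    rw [mem_span_range_smul_top_iff] at hx
    obtain ⟨l, hl⟩ := hx
    choose l' hl' using fun i => pL.surj (l i)
    obtain ⟨z, hz⟩ := (pL.π_eq_zero_iff (lU.V0 *ᵥ x - ∑ i, a i • l' i)).1 (by
      rw [map_sub, lU.π_mulVec, map_sum, sub_eq_zero, Submodule.subtype_apply]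
      simpa only [map_smul, hl'] using hl.symm)
    refine ⟨Sum.elim (fun p => l' p.1 p.2) z, ?_⟩
    rw [Matrix.fromCols_mulVec_sumElim, smulCol_transpose_mulVec, hz, add_sub_cancel]
  · intro x
    obtain ⟨w, z, h⟩ := lU.exists_mulVec_add_eq (a i • x) (by
      rw [Submodule.range_subtype, map_smul]
      exact Submodule.smul_mem_smul (Ideal.subset_span ⟨i, rfl⟩) trivial)
    exact ⟨Sum.elim w z, by
      rw [Matrix.fromCols_mulVec_sumElim, h, Matrix.smul_mulVec, Matrix.one_mulVec]⟩
  · intro α H ℘ h℘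
    have := h℘.isPrime
    intro Sα _ _ _ BL BT BU uT0 uU0 b hBL hBT hBU huT huU hb
    obtain ⟨⟨h1, h2, h3⟩, h4, h5, h6⟩ := H ℘ h℘ Sα
    have hL := fun i i' => (hBL i i').fracSpec
    have hT := fun i i' => (hBT i i').fracSpec
    have hU := fun i i' => (hBU i i').fracSpec
    have hT0 := fun i i' => (huT i i').fracSpec
    have hU0 := fun i i' => (huU i i').fracSpec
    have hb := fun i => (hb i).fracSpec
    refine ⟨fun _ => ⟨cokerMap_injective (h1 _ _ _ hT hT0 hL),
      range_cokerMap_eq_colonSubmodule b (h2 _ _ _ hb hT0 hL)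
        fun i => h3 i _ _ hL (.smul (hb i) hT0)⟩,
      fun _ => ⟨cokerMap_injective (h4 _ _ _ hU hU0 hL), range_cokerMap_eq_smul_top b
        (h5 _ _ (.fromCols (fun r p => matFracSpec_smulCol hb p r) hL) hU0)
        fun i => h6 i _ _ (.fromCols hU0 hL) (.smul (hb i) matFracSpec_one)⟩⟩

end Spl
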